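/- arXiv:1903.08850 — 7 statements merged into one kernel-verified Lean document; each statement's English description precedes it below -/
import Mathlib

section
/- Let s = [s_1, ..., s_n]^T be a real-valued vector of length n with entries sorted in descending order as s_[1] ≥ s_[2] ≥ ... ≥ s_[n]. Then for every k ∈ {1,...,n}, the sum of the k largest elements satisfies: Σ_{i=1}^k s_[i] = min over λ ∈ {s_1, s_2, ..., s_n} of (λk + Σ_{i=1}^n max(s_i − λ, 0)). -/
open Finset

/-- The sum of `f` over `t` is at most `c * #t` plus the total excess of `f` over `c`. -/
theorem sum_le_mul_card_add_sum_max {ι : Type*} [Fintype ι] (f : ι → ℝ) (c : ℝ) (t : Finset ι) :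
    ∑ i ∈ t, f i ≤ c * t.card + ∑ i, max (f i - c) 0 := by
  have h₁ : ∑ i ∈ t, (f i - c) ≤ ∑ i ∈ t, max (f i - c) 0 :=
    Finset.sum_le_sum fun i _ => le_max_left _ _
  have h₂ : ∑ i ∈ t, max (f i - c) 0 ≤ ∑ i, max (f i - c) 0 :=
    Finset.sum_le_sum_of_subset_of_nonneg (Finset.subset_univ t) fun i _ _ => le_max_right _ _
  rw [Finset.sum_sub_distrib, Finset.sum_const, nsmul_eq_mul] at h₁
  linarith

/-- Equality holds when `c` separates the values of `f` on `t` from those off `t`. -/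
theorem sum_eq_mul_card_add_sum_max {ι : Type*} [Fintype ι] (f : ι → ℝ) (c : ℝ) (t : Finset ι)
    (h_mem : ∀ i ∈ t, c ≤ f i) (h_notMem : ∀ i ∉ t, f i ≤ c) :
    ∑ i ∈ t, f i = c * t.card + ∑ i, max (f i - c) 0 := by
  have h₁ : ∑ i ∈ t, (f i - c) = ∑ i ∈ t, max (f i - c) 0 :=
    Finset.sum_congr rfl fun i hi => (max_eq_left (sub_nonneg.2 (h_mem i hi))).symm
  have h₂ : ∑ i ∈ t, max (f i - c) 0 = ∑ i, max (f i - c) 0 :=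
    Finset.sum_subset (Finset.subset_univ t) fun i _ hi =>
      max_eq_right (sub_nonpos.2 (h_notMem i hi))
  rw [Finset.sum_sub_distrib, Finset.sum_const, nsmul_eq_mul] at h₁
  linarith

/-- **Lemma 1 (variational identity for top-k sums).**
For a real vector `s` of length `n`, sorted in descending order via a permutation `σ`
(so `s (σ i)` is the `(i+1)`-th largest entry), the sum of the `k+1` largest elements
(`k : Fin n`, so the count `k+1` ranges over `{1,...,n}`) equals the minimum over
`λ ∈ {s_1,...,s_n}` of `λ·(k+1) + Σ_i max(s_i − λ, 0)`. -/
theorem topk_sum_eq_min (n : ℕ) (s : Fin n → ℝ) (σ : Equiv.Perm (Fin n))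
    (hσ : Antitone (fun i => s (σ i))) (k : Fin n) :
    IsLeast
      (Set.range fun j : Fin n =>
        s j * ((k : ℕ) + 1) + ∑ i : Fin n, max (s i - s j) 0)
      (∑ i ∈ Finset.univ.filter (fun i : Fin n => i ≤ k), s (σ i)) := by
  have h_card : (((Finset.univ.filter fun i : Fin n => i ≤ k).card : ℕ) : ℝ) = (k : ℕ) + 1 := by
    rw [Finset.filter_ge_eq_Iic, Fin.card_Iic]
    push_cast
    rfl
  have h_perm (c : ℝ) : ∑ i, max (s (σ i) - c) 0 = ∑ i, max (s i - c) 0 :=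
    Equiv.sum_comp σ fun i => max (s i - c) 0
  constructor
  · refine ⟨σ k, ?_⟩
    have h := sum_eq_mul_card_add_sum_max (fun i => s (σ i)) (s (σ k))
      (Finset.univ.filter fun i => i ≤ k) (fun i hi => hσ (Finset.mem_filter.1 hi).2)
      (fun i hi => hσ (le_of_not_ge fun hik => hi (Finset.mem_filter.2 ⟨Finset.mem_univ i, hik⟩)))
    rw [h_card, h_perm] at h
    exact h.symm
  · rintro _ ⟨j, rfl⟩
    have h := sum_le_mul_card_add_sum_max (fun i => s (σ i)) (s j)
      (Finset.univ.filter fun i => i ≤ k)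
    rwa [h_card, h_perm] at h
end

section
/- Let s = [s_1, ..., s_n]^T be a real-valued vector of length n and k ∈ {1,...,n}. Setting λ = s_[k] (the k-th largest entry of s), equality holds: λk + Σ_{i=1}^n max(s_i − λ, 0) = Σ_{i=1}^k s_[i]. -/
open Finset

/-- Setting `λ = s_[k]`, the `(k+1)`-th largest entry `s (σ k)` (where `σ` sorts `s`
in descending order and `k : Fin n` is the 0-based rank), equality holds:
`λ·(k+1) + Σ_i max(s_i − λ, 0) = Σ of the (k+1) largest entries`. -/
theorem topk_sum_eq_at_kth (n : ℕ) (s : Fin n → ℝ) (σ : Equiv.Perm (Fin n))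
    (hσ : Antitone (fun i => s (σ i))) (k : Fin n) :
    s (σ k) * ((k : ℕ) + 1) + ∑ i : Fin n, max (s i - s (σ k)) 0
      = ∑ i ∈ Finset.univ.filter (fun i : Fin n => i ≤ k), s (σ i) := by
  rw [← Equiv.sum_comp σ (fun i => max (s i - s (σ k)) 0)]
  have h_max : ∀ i : Fin n, max (s (σ i) - s (σ k)) 0
      = if i ≤ k then s (σ i) - s (σ k) else 0 := by
    intro i
    split_ifs with h
    · exact max_eq_left (sub_nonneg.mpr (hσ h))
    · exact max_eq_right (sub_nonpos.mpr (hσ (not_le.mp h).le))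
  have h_card : (Finset.univ.filter (fun i : Fin n => i ≤ k)).card = (k : ℕ) + 1 := by
    rw [Finset.filter_ge_eq_Iic, Fin.card_Iic]
  simp only [h_max]
  rw [← Finset.sum_filter, Finset.sum_sub_distrib, Finset.sum_const, h_card, nsmul_eq_mul]
  push_cast
  ring
end

section
/- Let s = [s_1, ..., s_n]^T be a real-valued vector with pairwise distinct entries and let k ∈ {1,...,n}. Then the unique index i ∈ {1,...,n} minimizing the quantity s_i·(2k − 1 − n) + Σ_{j=1}^n |s_j − s_i| over i is the index of the k-th largest entry, i.e., the minimizing index i satisfies s_i = s_[k]. -/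
open Finset

/-- The number of indices above `k` minus the number of indices below `k`. -/
theorem sum_sign_sub_index {n : ℕ} (k : Fin n) :
    ∑ l : Fin n, ((if k < l then (1 : ℝ) else 0) - (if l < k then (1 : ℝ) else 0))
      = (n : ℝ) - 1 - 2 * ((k : ℕ) : ℝ) := by
  have h_above : (univ.filter fun l : Fin n => k < l) = Ioi k := by ext; simp
  have h_below : (univ.filter fun l : Fin n => l < k) = Iio k := by ext; simp
  rw [sum_sub_distrib, sum_boole, sum_boole, h_above, h_below, Fin.card_Ioi, Fin.card_Iio,
    Nat.sub_sub, Nat.cast_sub (by omega)]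
  push_cast
  ring

/-- The objective `y (2(k+1) - 1 - n) + ∑ l, |t l - y|` grows at least linearly in the
distance from `t k`, for `t` sorted in descending order. -/
theorem objective_add_abs_sub_le {n : ℕ} {t : Fin n → ℝ} (ht : Antitone t) (k : Fin n) (y : ℝ) :
    t k * (2 * (((k : ℕ) : ℝ) + 1) - 1 - (n : ℝ)) + ∑ l : Fin n, |t l - t k| + |y - t k|
      ≤ y * (2 * (((k : ℕ) : ℝ) + 1) - 1 - (n : ℝ)) + ∑ l : Fin n, |t l - y| := by
  have h_term : ∀ l ∈ (univ : Finset (Fin n)),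
      |t l - t k| + (if l = k then |y - t k| else 0)
          + (y - t k) * ((if k < l then (1 : ℝ) else 0) - (if l < k then (1 : ℝ) else 0))
        ≤ |t l - y| := by
    intro l _
    rcases lt_trichotomy l k with h | rfl | h
    · have h_le := ht h.le
      simp only [h, h.ne, h.not_gt, if_true, if_false, abs_of_nonneg (sub_nonneg.2 h_le)]
      linarith [le_abs_self (t l - y)]
    · simp [abs_sub_comm]
    · have h_le := ht h.le
      simp only [h, h.ne', h.not_gt, if_true, if_false, abs_of_nonpos (sub_nonpos.2 h_le)]
      linarith [neg_abs_le (t l - y)]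
  have h_sum := sum_le_sum h_term
  rw [sum_add_distrib, sum_add_distrib, ← mul_sum, sum_sign_sub_index,
    sum_ite_eq' univ k, if_pos (mem_univ k)] at h_sum
  linarith

/-- For `s` with pairwise distinct entries sorted in descending order by `σ` and a
0-based rank `k : Fin n`, the unique index `i` minimizing
`s_i·(2(k+1) − 1 − n) + Σ_j |s_j − s_i|` is `σ k`, the index of the `(k+1)`-th largest
entry. -/
theorem kth_largest_argmin (n : ℕ) (s : Fin n → ℝ) (hs : Function.Injective s)
    (σ : Equiv.Perm (Fin n)) (hσ : Antitone (fun i => s (σ i))) (k : Fin n) :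
    (∀ j : Fin n,
        s (σ k) * (2 * (((k : ℕ) : ℝ) + 1) - 1 - (n : ℝ)) + ∑ l : Fin n, |s l - s (σ k)|
          ≤ s j * (2 * (((k : ℕ) : ℝ) + 1) - 1 - (n : ℝ)) + ∑ l : Fin n, |s l - s j|)
      ∧ ∀ i : Fin n,
        (∀ j : Fin n,
          s i * (2 * (((k : ℕ) : ℝ) + 1) - 1 - (n : ℝ)) + ∑ l : Fin n, |s l - s i|
            ≤ s j * (2 * (((k : ℕ) : ℝ) + 1) - 1 - (n : ℝ)) + ∑ l : Fin n, |s l - s j|)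
          → i = σ k := by
  have h_growth (j : Fin n) := objective_add_abs_sub_le hσ k (s j)
  have h_reindex (y : ℝ) : ∑ l, |s (σ l) - y| = ∑ l, |s l - y| :=
    Equiv.sum_comp σ fun l => |s l - y|
  simp only [h_reindex] at h_growth
  refine ⟨fun j => by linarith [h_growth j, abs_nonneg (s j - s (σ k))], fun i hi => hs ?_⟩
  have h_abs : |s i - s (σ k)| ≤ 0 := by linarith [h_growth i, hi (σ k)]
  exact sub_eq_zero.1 (abs_nonpos_iff.1 h_abs)
end

section
/- Let s = [s_1, ..., s_n]^T be a real-valued vector with pairwise distinct entries. Let A_s be the n×n matrix with entries A_s[i,j] = |s_i − s_j|, and let 𝟙 denote the all-ones column vector. Let sort(s) be the permutation mapping each rank i to the index of the i-th largest entry of s, with associated permutation matrix P_{sort(s)}[i,j] = 1 if j = sort(s)_i and 0 otherwise. Then for every i, j ∈ {1,...,n}: P_{sort(s)}[i,j] = 1 if and only if j = argmax over j' of the vector (n + 1 − 2i)·s − A_s·𝟙 evaluated at coordinate j'; equivalently, P_{sort(s)}[i,j] = 1 iff j uniquely maximizes (n+1−2i)s_{j'} − Σ_{l=1}^n |s_{j'}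 − s_l| over j'. -/
open Finset

/-- The sign of `l - i`, summed over all `l`, counts the indices after `i` minus those before. -/
lemma sum_one_sub_ite_lt_sub_ite_eq (n : ℕ) (i : Fin n) :
    ∑ l : Fin n, ((1 : ℝ) - 2 * (if l < i then 1 else 0) - (if l = i then 1 else 0))
      = (n : ℝ) + 1 - 2 * (((i : ℕ) : ℝ) + 1) := by
  have h : ∑ l : Fin n, (if l < i then (1 : ℝ) else 0) = ((i : ℕ) : ℝ) := by
    rw [Finset.sum_boole, Finset.filter_gt_eq_Iio, Fin.card_Iio]
  rw [Finset.sum_sub_distrib, Finset.sum_sub_distrib, ← Finset.mul_sum, h]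
  simp
  ring

/-- The `i`-th order statistic of an antitone family is the unique maximizer of the tilted
sum of negated absolute deviations. -/
lemma mul_sub_sum_abs_sub_lt_of_antitone {n : ℕ} {t : Fin n → ℝ} (ht : Antitone t) (i : Fin n)
    {x : ℝ} (hx : x ≠ t i) :
    ((n : ℝ) + 1 - 2 * (((i : ℕ) : ℝ) + 1)) * x - ∑ l : Fin n, |x - t l|
      < ((n : ℝ) + 1 - 2 * (((i : ℕ) : ℝ) + 1)) * t i - ∑ l : Fin n, |t i - t l| := by
  rw [← sum_one_sub_ite_lt_sub_ite_eq, Finset.sum_mul, Finset.sum_mul,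
    ← Finset.sum_sub_distrib, ← Finset.sum_sub_distrib]
  refine Finset.sum_lt_sum (fun l _ => ?_) ⟨i, Finset.mem_univ i, ?_⟩
  · rcases lt_trichotomy l i with h | rfl | h
    · have hl := ht h.le
      rw [if_pos h, if_neg h.ne, abs_of_nonpos (sub_nonpos.2 hl)]
      linarith [neg_abs_le (x - t l)]
    · simp
    · have hl := ht h.le
      rw [if_neg h.not_gt, if_neg h.ne', abs_of_nonneg (sub_nonneg.2 hl)]
      linarith [le_abs_self (x - t l)]
  · simpa using sub_ne_zero.2 hx

/-- For `s` with pairwise distinct entries, let `σ = sort(s)` be the permutation sending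
each 0-based rank `i` to the index of the `(i+1)`-th largest entry (so `s ∘ σ` is
antitone). Then the permutation matrix of `σ` has a `1` at `(i,j)` (i.e. `σ i = j`)
iff `j` uniquely maximizes `(n + 1 − 2(i+1))·s_{j'} − Σ_l |s_{j'} − s_l|` over `j'`. -/
theorem sort_perm_matrix_argmax (n : ℕ) (s : Fin n → ℝ) (hs : Function.Injective s)
    (σ : Equiv.Perm (Fin n)) (hσ : Antitone (fun i => s (σ i))) (i j : Fin n) :
    σ i = j ↔
      ∀ j' : Fin n, j' ≠ j →
        ((n : ℝ) + 1 - 2 * (((i : ℕ) : ℝ) + 1)) * s j' - ∑ l : Fin n, |s j' - s l|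
          < ((n : ℝ) + 1 - 2 * (((i : ℕ) : ℝ) + 1)) * s j - ∑ l : Fin n, |s j - s l| := by
  have key (k : Fin n) (hk : k ≠ σ i) :
      ((n : ℝ) + 1 - 2 * (((i : ℕ) : ℝ) + 1)) * s k - ∑ l : Fin n, |s k - s l|
        < ((n : ℝ) + 1 - 2 * (((i : ℕ) : ℝ) + 1)) * s (σ i) - ∑ l : Fin n, |s (σ i) - s l| := by
    have h := mul_sub_sum_abs_sub_lt_of_antitone hσ i (x := s k) (hs.ne hk)
    rwa [Equiv.sum_comp σ (fun l => |s k - s l|),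
      Equiv.sum_comp σ (fun l => |s (σ i) - s l|)] at h
  constructor
  · rintro rfl
    exact key
  · intro h
    by_contra hne
    exact lt_asymm (h _ hne) (key j (Ne.symm hne))
end

section
/- Let s ∈ ℝ^n have pairwise distinct entries. Define, for τ > 0, the relaxed sort matrix P̂_{sort(s)}(τ) whose i-th row is softmax(((n + 1 − 2i)·s − A_s·𝟙)/τ), where A_s[i,j] = |s_i − s_j| and 𝟙 is the all-ones vector, and let P_{sort(s)} be the permutation matrix of the descending-sort permutation of s. Then for every i, j ∈ {1,...,n}: lim_{τ → 0+} P̂_{sort(s)}(τ)[i,j] = P_{sort(s)}[i,j]. -/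
open Finset

/-- The relaxed sort matrix: its `i`-th row is
`softmax(((n + 1 − 2(i+1))·s − A_s·𝟙)/τ)` (0-based row index `i`), where
`A_s[j,l] = |s_j − s_l|`. -/
noncomputable def relaxedSort (n : ℕ) (s : Fin n → ℝ) (τ : ℝ) (i j : Fin n) : ℝ :=
  Real.exp ((((n : ℝ) + 1 - 2 * (((i : ℕ) : ℝ) + 1)) * s j - ∑ l : Fin n, |s j - s l|) / τ) /
    ∑ j' : Fin n,
      Real.exp ((((n : ℝ) + 1 - 2 * (((i : ℕ) : ℝ) + 1)) * s j' - ∑ l : Fin n, |s j' - s l|) / τ)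

/-- As the temperature tends to `0` from above, the softmax of `f / τ` concentrates on the strict
maximizer of `f`. -/
theorem tendsto_softmax_of_strict_max {ι : Type*} [Fintype ι] [DecidableEq ι] (f : ι → ℝ) (a : ι)
    (hf : ∀ k, k ≠ a → f k < f a) (j : ι) :
    Filter.Tendsto (fun τ : ℝ => Real.exp (f j / τ) / ∑ k, Real.exp (f k / τ))
      (nhdsWithin 0 (Set.Ioi 0)) (nhds (if j = a then (1 : ℝ) else 0)) := by
  have hlim (k : ι) : Filter.Tendsto (fun τ : ℝ => Real.exp ((f k - f a) / τ))
      (nhdsWithin 0 (Set.Ioi 0)) (nhds (if k = a then (1 : ℝ) else 0)) := by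
    split_ifs with hk
    · simp [hk]
    · simp only [div_eq_mul_inv]
      exact Real.tendsto_exp_atBot.comp
        (tendsto_inv_nhdsGT_zero.const_mul_atTop_of_neg (sub_neg.2 (hf k hk)))
  have hsum : Filter.Tendsto (fun τ : ℝ => ∑ k, Real.exp ((f k - f a) / τ))
      (nhdsWithin 0 (Set.Ioi 0)) (nhds 1) := by
    simpa using tendsto_finsetSum univ fun k _ => hlim k
  have hdiv := (hlim j).div hsum one_ne_zero
  rw [div_one] at hdiv
  refine hdiv.congr fun τ => ?_
  simp only [Pi.div_apply, sub_div, Real.exp_sub, ← Finset.sum_div]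
  exact div_div_div_cancel_right₀ (Real.exp_ne_zero _) _ _

/-- The number of indices above `i` minus the number of indices below `i`. -/
theorem Fin.sum_order_sign {n : ℕ} (i : Fin n) :
    ∑ l : Fin n, (if i < l then (1 : ℝ) else if l < i then -1 else 0) =
      (n : ℝ) + 1 - 2 * (((i : ℕ) : ℝ) + 1) := by
  have hsplit (l : Fin n) : (if i < l then (1 : ℝ) else if l < i then -1 else 0) =
      (if i < l then 1 else 0) - (if l < i then 1 else 0) := by
    rcases lt_trichotomy i l with h | rfl | h
    · simp [h, h.not_gt]
    · simp
    · simp [h, h.not_gt]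
  have hi : i.val + 1 ≤ n := i.isLt
  simp only [hsplit, Finset.sum_sub_distrib, Finset.sum_boole, Finset.filter_lt_eq_Ioi,
    Finset.filter_gt_eq_Iio, Fin.card_Ioi, Fin.card_Iio]
  rw [Nat.sub_sub, add_comm 1, Nat.cast_sub hi]
  push_cast
  ring

/-- For a strictly decreasing `t`, the `i`-th row score has its strict maximum at `i`. -/
theorem StrictAnti.row_score_lt {n : ℕ} {t : Fin n → ℝ} (ht : StrictAnti t) {i k : Fin n}
    (hk : k ≠ i) :
    ((n : ℝ) + 1 - 2 * (((i : ℕ) : ℝ) + 1)) * t k - ∑ l : Fin n, |t k - t l| <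
      ((n : ℝ) + 1 - 2 * (((i : ℕ) : ℝ) + 1)) * t i - ∑ l : Fin n, |t i - t l| := by
  simp only [← Fin.sum_order_sign, Finset.sum_mul, ← Finset.sum_sub_distrib]
  refine Finset.sum_lt_sum (fun l _ => ?_) ⟨i, mem_univ i, ?_⟩
  · rcases lt_trichotomy i l with h | rfl | h
    · rw [if_pos h, abs_of_pos (sub_pos.2 (ht h))]
      linarith [le_abs_self (t k - t l)]
    · simp
    · rw [if_neg h.not_gt, if_pos h, abs_of_neg (sub_neg.2 (ht h))]
      linarith [neg_abs_le (t k - t l)]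
  · simpa using sub_ne_zero.2 (ht.injective.ne hk)

/-- For `s` with pairwise distinct entries and descending-sort permutation `σ`
(i.e. `s ∘ σ` antitone), each entry of the relaxed sort matrix converges, as
`τ → 0⁺`, to the corresponding entry of the permutation matrix of `σ`
(which is `1` if `j = σ i` and `0` otherwise). -/
theorem relaxedSort_tendsto_perm_matrix (n : ℕ) (s : Fin n → ℝ)
    (hs : Function.Injective s) (σ : Equiv.Perm (Fin n))
    (hσ : Antitone (fun i => s (σ i))) (i j : Fin n) :
    Filter.Tendsto (fun τ : ℝ => relaxedSort n s τ i j)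
      (nhdsWithin 0 (Set.Ioi 0)) (nhds (if j = σ i then (1 : ℝ) else 0)) := by
  have ht : StrictAnti fun i => s (σ i) := hσ.strictAnti_of_injective (hs.comp σ.injective)
  refine tendsto_softmax_of_strict_max
    (fun k => ((n : ℝ) + 1 - 2 * (((i : ℕ) : ℝ) + 1)) * s k - ∑ l : Fin n, |s k - s l|)
    (σ i) (fun k hk => ?_) j
  have hlt := ht.row_score_lt (i := i) (k := σ.symm k) (by simpa [Equiv.symm_apply_eq] using hk)
  simpa only [Equiv.apply_symm_apply, Equiv.sum_comp σ fun l => |s k - s l|,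
    Equiv.sum_comp σ fun l => |s (σ i) - s l|] using hlt
end

section
/- Let s ∈ ℝ^n, τ > 0, and let P̂ be the relaxed sort matrix whose i-th row is softmax(((n + 1 − 2i)·s − A_s·𝟙)/τ), where A_s[i,j] = |s_i − s_j| and 𝟙 is the all-ones vector. For each row i, let argmaxset(P̂[i,:]) = {j : P̂[i,j] = max_l P̂[i,l]}. Then for any two rows i_1, i_2 ∈ {1,...,n}: if argmaxset(P̂[i_1,:]) ∩ argmaxset(P̂[i_2,:]) ≠ ∅, then argmaxset(P̂[i_1,:]) = argmaxset(P̂[i_2,:]). -/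
open Finset

/-- The logit of column `j` in row `i` of the relaxed sort matrix, before dividing by `τ`. -/
noncomputable def sortScore (n : ℕ) (s : Fin n → ℝ) (i j : Fin n) : ℝ :=
  ((n : ℝ) + 1 - 2 * (((i : ℕ) : ℝ) + 1)) * s j - ∑ l : Fin n, |s j - s l|

lemma relaxedSort_le_iff {n : ℕ} (s : Fin n → ℝ) {τ : ℝ} (hτ : 0 < τ) (i l j : Fin n) :
    relaxedSort n s τ i l ≤ relaxedSort n s τ i j ↔ sortScore n s i l ≤ sortScore n s i j := by
  have hpos : 0 < ∑ j' : Fin n, Real.exp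
      ((((n : ℝ) + 1 - 2 * (((i : ℕ) : ℝ) + 1)) * s j' - ∑ l : Fin n, |s j' - s l|) / τ) :=
    Finset.sum_pos (fun _ _ => Real.exp_pos _) ⟨i, Finset.mem_univ i⟩
  unfold relaxedSort sortScore
  rw [div_le_div_iff_of_pos_right hpos, Real.exp_le_exp, div_le_div_iff_of_pos_right hτ]

lemma sub_mul_abs_sub_le {a b c : ℝ} (hac : a ≤ c) (hcb : c ≤ b) (x : ℝ) :
    (b - a) * |c - x| ≤ (b - c) * |a - x| + (c - a) * |b - x| := by
  calc (b - a) * |c - x| = |(b - c) * (a - x) + (c - a) * (b - x)| := by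
        rw [show (b - c) * (a - x) + (c - a) * (b - x) = (b - a) * (c - x) by ring, abs_mul,
          abs_of_nonneg (sub_nonneg.2 (hac.trans hcb))]
    _ ≤ |(b - c) * (a - x)| + |(c - a) * (b - x)| := abs_add_le _ _
    _ = (b - c) * |a - x| + (c - a) * |b - x| := by
        rw [abs_mul, abs_mul, abs_of_nonneg (sub_nonneg.2 hcb), abs_of_nonneg (sub_nonneg.2 hac)]

/-- Scores are concave in the value of the column. -/
lemma sortScore_concave {n : ℕ} (s : Fin n → ℝ) (i : Fin n) {j p k : Fin n}
    (hjp : s j ≤ s p) (hpk : s p ≤ s k) :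
    (s k - s p) * sortScore n s i j + (s p - s j) * sortScore n s i k ≤
      (s k - s j) * sortScore n s i p := by
  have hsum : (s k - s j) * ∑ l, |s p - s l| ≤
      (s k - s p) * ∑ l, |s j - s l| + (s p - s j) * ∑ l, |s k - s l| := by
    simp only [Finset.mul_sum, ← Finset.sum_add_distrib]
    exact Finset.sum_le_sum fun l _ => sub_mul_abs_sub_le hjp hpk (s l)
  unfold sortScore
  linarith

/-- By parity, a score is never constant between two consecutive values. -/
lemma sortScore_ne_of_adjacent {n : ℕ} (s : Fin n → ℝ) (i : Fin n) {j p : Fin n}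
    (hjp : s j < s p) (hadj : ∀ l, s j < s l → s p ≤ s l) :
    sortScore n s i p ≠ sortScore n s i j := by
  intro heq
  have hdiff : ∑ l, |s p - s l| - ∑ l, |s j - s l| =
      (s p - s j) * ((∑ l, (if s l ≤ s j then 1 else -1) : ℤ) : ℝ) := by
    push_cast
    rw [← Finset.sum_sub_distrib, Finset.mul_sum]
    refine Finset.sum_congr rfl fun l _ => ?_
    split_ifs with hl
    · rw [abs_of_nonneg (by linarith), abs_of_nonneg (by linarith)]
      ring
    · have hpl := hadj l (not_le.1 hl)
      rw [abs_of_nonpos (by linarith), abs_of_nonpos (by linarith)]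
      ring
  have hsigns : (∑ l : Fin n, (if s l ≤ s j then 1 else -1) : ℤ) =
      2 * (∑ l : Fin n, if s l ≤ s j then 1 else 0) - n := by
    have hcard : (n : ℤ) = ∑ _l : Fin n, (1 : ℤ) := by simp
    rw [hcard, Finset.mul_sum, ← Finset.sum_sub_distrib]
    refine Finset.sum_congr rfl fun l _ => ?_
    split_ifs <;> norm_num
  rw [hsigns] at hdiff
  generalize (∑ l : Fin n, if s l ≤ s j then (1 : ℤ) else 0) = m at hdiff
  unfold sortScore at heq
  have hslope : (n : ℝ) + 1 - 2 * (((i : ℕ) : ℝ) + 1) = ((2 * m - n : ℤ) : ℝ) := by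
    apply mul_left_cancel₀ (sub_pos.2 hjp).ne'
    linarith
  have hint : (n : ℤ) + 1 - 2 * ((i : ℕ) + 1) = 2 * m - n := by exact_mod_cast hslope
  omega

lemma sortScore_max_not_lt {n : ℕ} (s : Fin n → ℝ) (i : Fin n) {j k : Fin n}
    (hj : ∀ l, sortScore n s i l ≤ sortScore n s i j)
    (hk : ∀ l, sortScore n s i l ≤ sortScore n s i k) : ¬ s j < s k := by
  intro hjk
  obtain ⟨p, hp, hmin⟩ := Finset.exists_min_image (Finset.univ.filter fun l => s j < s l) s
    ⟨k, by simpa using hjk⟩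
  simp only [Finset.mem_filter, Finset.mem_univ, true_and] at hp hmin
  have hconc := sortScore_concave s i hp.le (hmin k hjk)
  rw [le_antisymm (hj k) (hk j)] at hconc
  refine sortScore_ne_of_adjacent s i hp hmin (le_antisymm (hj p) ?_)
  refine le_of_mul_le_mul_left ?_ (sub_pos.2 hjk)
  linarith

/-- Given one maximizer of a row, the maximizers are the columns with the same value. -/
lemma sortScore_max_iff {n : ℕ} (s : Fin n → ℝ) (i : Fin n) {j : Fin n}
    (hj : ∀ l, sortScore n s i l ≤ sortScore n s i j) (k : Fin n) :
    (∀ l, sortScore n s i l ≤ sortScore n s i k) ↔ s k = s j := by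
  constructor
  · intro hk
    exact le_antisymm (not_lt.1 (sortScore_max_not_lt s i hj hk))
      (not_lt.1 (sortScore_max_not_lt s i hk hj))
  · intro hkj
    have hscore : sortScore n s i k = sortScore n s i j := by simp only [sortScore, hkj]
    rwa [hscore]

/-- If the argmax sets (sets of columns where the row attains its maximum) of two rows
of the relaxed sort matrix intersect, then they coincide. -/
theorem relaxedSort_argmaxset_eq_of_inter_nonempty (n : ℕ) (s : Fin n → ℝ) (τ : ℝ)
    (hτ : 0 < τ) (i₁ i₂ : Fin n)
    (h : ∃ j : Fin n, (∀ l : Fin n, relaxedSort n s τ i₁ l ≤ relaxedSort n s τ i₁ j)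
        ∧ (∀ l : Fin n, relaxedSort n s τ i₂ l ≤ relaxedSort n s τ i₂ j)) :
    ∀ j : Fin n, (∀ l : Fin n, relaxedSort n s τ i₁ l ≤ relaxedSort n s τ i₁ j)
        ↔ (∀ l : Fin n, relaxedSort n s τ i₂ l ≤ relaxedSort n s τ i₂ j) := by
  simp only [relaxedSort_le_iff s hτ] at h ⊢
  obtain ⟨j₀, h₁, h₂⟩ := h
  intro j
  rw [sortScore_max_iff s i₁ h₁, sortScore_max_iff s i₂ h₂]
end

section
/- Let s ∈ ℝ^n with pairwise distinct entries, and let k, k' ∈ {1,...,n} with k < k'. If λ, λ' ∈ ℝ satisfy λk + Σ_{i=1}^n max(s_i − λ, 0) = Σ_{i=1}^k s_[i] and λ'k' + Σ_{i=1}^n max(s_i − λ', 0) = Σ_{i=1}^{k'} s_[i] (i.e., λ and λ' are minimizers at levels k and k' respectively), then λ ≥ λ'. In particular, the k-th largest entry function k ↦ s_[k] is strictly decreasing and the intervals of minimizers [s_[k+1], s_[k]] for different k ∈ {1,...,n−1} have pairwise disjoint interiors. -/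
open Finset

/-- A real number attaining the top-`(k+1)` sum in the variational identity separates the entries
of rank at most `k` from the others. -/
theorem topk_minimizer_separates {n : ℕ} (s : Fin n → ℝ) (σ : Equiv.Perm (Fin n)) (k : Fin n)
    (lam : ℝ)
    (h : lam * ((k : ℕ) + 1) + ∑ i : Fin n, max (s i - lam) 0
        = ∑ i ∈ Finset.univ.filter (fun i : Fin n => i ≤ k), s (σ i)) :
    (∀ i, i ≤ k → lam ≤ s (σ i)) ∧ ∀ i, k < i → s (σ i) ≤ lam := by
  have hcard : (Finset.univ.filter (fun i : Fin n => i ≤ k)).card = (k : ℕ) + 1 := by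
    rw [Finset.filter_ge_eq_Iic, Fin.card_Iic]
  have hnonneg : ∀ i ∈ (Finset.univ : Finset (Fin n)),
      0 ≤ max (s (σ i) - lam) 0 - if i ≤ k then s (σ i) - lam else 0 := by
    intro i _
    split_ifs
    · exact sub_nonneg.2 (le_max_left _ _)
    · simp
  have hsum : ∑ i : Fin n, (max (s (σ i) - lam) 0 - if i ≤ k then s (σ i) - lam else 0) = 0 := by
    rw [Finset.sum_sub_distrib, Equiv.sum_comp σ (fun i => max (s i - lam) 0),
      ← Finset.sum_filter, Finset.sum_sub_distrib, Finset.sum_const, hcard, nsmul_eq_mul]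
    push_cast
    linarith
  have hzero := (Finset.sum_eq_zero_iff_of_nonneg hnonneg).1 hsum
  refine ⟨fun i hi => ?_, fun i hi => ?_⟩
  · have hi0 := hzero i (Finset.mem_univ i)
    rw [if_pos hi] at hi0
    linarith [le_max_right (s (σ i) - lam) 0]
  · have hi0 := hzero i (Finset.mem_univ i)
    rw [if_neg hi.not_ge] at hi0
    linarith [le_max_left (s (σ i) - lam) 0]

/-- Monotonicity of minimizers of the top-k variational identity: for `s` with
pairwise distinct entries sorted in descending order by `σ`, 0-based ranks
`k < k'`, and reals `λ, λ'` that are minimizers at levels `k` and `k'` respectively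
(i.e. they achieve the top-`(k+1)` and top-`(k'+1)` sums in the variational identity),
we have `λ ≥ λ'`. In particular the `k`-th largest entry function is strictly
decreasing (so the intervals of minimizers for different levels have pairwise
disjoint interiors). -/
theorem topk_minimizers_monotone (n : ℕ) (s : Fin n → ℝ) (hs : Function.Injective s)
    (σ : Equiv.Perm (Fin n)) (hσ : Antitone (fun i => s (σ i)))
    (k k' : Fin n) (hkk' : k < k') (lam lam' : ℝ)
    (h1 : lam * ((k : ℕ) + 1) + ∑ i : Fin n, max (s i - lam) 0
        = ∑ i ∈ Finset.univ.filter (fun i : Fin n => i ≤ k), s (σ i))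
    (h2 : lam' * ((k' : ℕ) + 1) + ∑ i : Fin n, max (s i - lam') 0
        = ∑ i ∈ Finset.univ.filter (fun i : Fin n => i ≤ k'), s (σ i)) :
    lam' ≤ lam ∧ ∀ a b : Fin n, a < b → s (σ b) < s (σ a) := by
  refine ⟨?_, fun a b hab => ?_⟩
  · exact ((topk_minimizer_separates s σ k' lam' h2).1 k' le_rfl).trans
      ((topk_minimizer_separates s σ k lam h1).2 k' hkk')
  · exact hσ.strictAnti_of_injective (hs.comp σ.injective) hab
end
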